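/- Multiplicativity theorem: let ρ be a unitary representation of G = GL(α+k∞, ℚ_p) on a complex Hilbert space 𝓗 (a group homomorphism of G into the unitary group of 𝓗), let 𝓗^K = {v ∈ 𝓗 : ρ(x)v = v for all x ∈ K}, and let P be the orthogonal projection of 𝓗 onto 𝓗^K. Then for all g, h ∈ G there exists N₀ such that for all N ≥ N₀: P ∘ ρ(g) ∘ P ∘ ρ(h) ∘ P = P ∘ ρ(g·𝔍(Θ_N)·h) ∘ P. -/

import Mathlib

open scoped BigOperators

/-- The identity matrix over `ℚ_p`, with an arbitrary index set. -/
noncomputable def idMat (p : ℕ) [Fact p.Prime] {I : Type*} [DecidableEq I] : I → I → ℚ_[p] :=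
  fun i j => if i = j then 1 else 0

/-- Product of two (possibly infinite) matrices over `ℚ_p`; the sum is a `finsum`, which is
well defined for the finitary matrices considered here. -/
noncomputable def matMul (p : ℕ) [Fact p.Prime] {I : Type*} (A B : I → I → ℚ_[p]) : I → I → ℚ_[p] :=
  fun i j => ∑ᶠ l, A i l * B l j

/-- A matrix is *finitary* if it differs from the identity matrix in finitely many entries. -/
def IsFinitary (p : ℕ) [Fact p.Prime] {I : Type*} [DecidableEq I] (A : I → I → ℚ_[p]) : Prop :=
  {x : I × I | A x.1 x.2 ≠ idMat p x.1 x.2}.Finite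

/-- A matrix is invertible if it has a two-sided inverse. -/
def IsInvMat (p : ℕ) [Fact p.Prime] {I : Type*} [DecidableEq I] (A : I → I → ℚ_[p]) : Prop :=
  ∃ B : I → I → ℚ_[p], matMul p A B = idMat p ∧ matMul p B A = idMat p

/-- Membership in `O(∞, ℤ_p)`: an `ℕ × ℕ` matrix with entries in `ℤ_p` (p-adic norm at most 1),
differing from the identity in finitely many entries, with `uᵗ u = 1`. -/
def IsOrth (p : ℕ) [Fact p.Prime] (u : ℕ → ℕ → ℚ_[p]) : Prop :=
  (∀ i j, ‖u i j‖ ≤ 1) ∧ IsFinitary p u ∧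
    ∀ i j, (∑ᶠ l, u l i * u l j) = idMat p i j

/-- The diagonal embedding `𝔍 : O(∞, ℤ_p) → GL(α + k∞, ℚ_p)`: identity on the first `α`
coordinates, and `u` on each of the `k` copies of the `ℕ`-indexed coordinates. -/
noncomputable def Jembed (p : ℕ) [Fact p.Prime] (α k : ℕ) (u : ℕ → ℕ → ℚ_[p]) :
    (Fin α ⊕ Fin k × ℕ) → (Fin α ⊕ Fin k × ℕ) → ℚ_[p] :=
  fun i j =>
    match i, j with
    | Sum.inl a, Sum.inl b => if a = b then 1 else 0
    | Sum.inr si, Sum.inr tj => if si.1 = tj.1 then u si.2 tj.2 else 0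
    | _, _ => 0

/-- The matrix `Θ_N ∈ O(∞, ℤ_p)` exchanging `e_i` and `e_{N+i}` for `i < N` and fixing `e_j`
for `j ≥ 2N` (0-indexed). -/
noncomputable def ThetaMat (p : ℕ) [Fact p.Prime] (N : ℕ) : ℕ → ℕ → ℚ_[p] :=
  fun i j => if i = (if j < N then j + N else if j < 2 * N then j - N else j) then 1 else 0


/-- Membership in the group `G = GL(α + k∞, ℚ_p)`. -/
def InGL (p : ℕ) [Fact p.Prime] (α k : ℕ)
    (g : (Fin α ⊕ Fin k × ℕ) → (Fin α ⊕ Fin k × ℕ) → ℚ_[p]) : Prop :=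
  IsFinitary p g ∧ IsInvMat p g

section BlockMatrices

variable {p : ℕ} [Fact p.Prime] {I : Type*} [DecidableEq I]

/-- `A` agrees with the identity matrix outside the square block `S × S`. -/
def IdOff (S : Finset I) (A : I → I → ℚ_[p]) : Prop :=
  ∀ i j, (i ∉ S ∨ j ∉ S) → A i j = idMat p i j

/-- The square block of `A` indexed by `S`. -/
def toBlock (S : Finset I) (A : I → I → ℚ_[p]) : Matrix S S ℚ_[p] :=
  Matrix.of fun i j => A i j

theorem idOff_idMat (S : Finset I) : IdOff S (idMat p : I → I → ℚ_[p]) := fun _ _ _ => rfl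

theorem toBlock_idMat (S : Finset I) : toBlock S (idMat p : I → I → ℚ_[p]) = 1 := by
  ext i j
  rw [Matrix.one_apply]
  exact if_congr Subtype.ext_iff.symm rfl rfl

theorem IdOff.mono {S T : Finset I} {A : I → I → ℚ_[p]} (hA : IdOff S A) (hST : S ⊆ T) :
    IdOff T A := fun i j h => hA i j (h.imp (fun h h' => h (hST h')) fun h h' => h (hST h'))

theorem IdOff.transpose {S : Finset I} {A : I → I → ℚ_[p]} (hA : IdOff S A) :
    IdOff S (fun i j => A j i) := fun i j h => by
  refine (hA j i h.symm).trans ?_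
  exact if_congr eq_comm rfl rfl

theorem IdOff.isFinitary {S : Finset I} {A : I → I → ℚ_[p]} (hA : IdOff S A) :
    IsFinitary p A := by
  refine (S ×ˢ S).finite_toSet.subset fun x hx => ?_
  by_contra h
  refine hx (hA _ _ ?_)
  simp only [Finset.mem_coe, Finset.mem_product] at h
  tauto

theorem IsFinitary.exists_idOff {A : I → I → ℚ_[p]} (hA : IsFinitary p A) :
    ∃ S : Finset I, IdOff S A := by
  refine ⟨hA.toFinset.image Prod.fst ∪ hA.toFinset.image Prod.snd, fun i j h => ?_⟩
  by_contra hij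
  have hmem : (i, j) ∈ hA.toFinset := (Set.Finite.mem_toFinset hA).2 hij
  have h1 := Finset.mem_image_of_mem Prod.fst hmem
  have h2 := Finset.mem_image_of_mem Prod.snd hmem
  simp only [Finset.mem_union, not_or] at h
  tauto

theorem IdOff.ext {S : Finset I} {A B : I → I → ℚ_[p]} (hA : IdOff S A) (hB : IdOff S B)
    (h : toBlock S A = toBlock S B) : A = B := by
  funext i j
  by_cases hij : i ∈ S ∧ j ∈ S
  · exact congrFun (congrFun h ⟨i, hij.1⟩) ⟨j, hij.2⟩
  · rw [hA i j (by tauto), hB i j (by tauto)]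

theorem idMat_matMul (A : I → I → ℚ_[p]) : matMul p (idMat p) A = A := by
  funext i j
  rw [matMul, finsum_eq_single _ i fun l hl => by simp [idMat, hl.symm]]
  simp [idMat]

theorem matMul_idMat (A : I → I → ℚ_[p]) : matMul p A (idMat p) = A := by
  funext i j
  rw [matMul, finsum_eq_single _ j fun l hl => by simp [idMat, hl]]
  simp [idMat]

theorem IdOff.matMul_apply_of_notMem_left {S : Finset I} {A : I → I → ℚ_[p]} (hA : IdOff S A)
    (B : I → I → ℚ_[p]) {i : I} (hi : i ∉ S) (j : I) : matMul p A B i j = B i j := by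
  conv_rhs => rw [← idMat_matMul B]
  exact finsum_congr fun l => by rw [hA i l (Or.inl hi)]

theorem IdOff.matMul_apply_of_notMem_right {S : Finset I} {B : I → I → ℚ_[p]} (hB : IdOff S B)
    (A : I → I → ℚ_[p]) (i : I) {j : I} (hj : j ∉ S) : matMul p A B i j = A i j := by
  conv_rhs => rw [← matMul_idMat A]
  exact finsum_congr fun l => by rw [hB l j (Or.inr hj)]

theorem IdOff.matMul {S : Finset I} {A B : I → I → ℚ_[p]} (hA : IdOff S A) (hB : IdOff S B) :
    IdOff S (matMul p A B) := by
  intro i j h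
  by_cases hi : i ∈ S
  · have hj : j ∉ S := by tauto
    rw [hB.matMul_apply_of_notMem_right A i hj, hA i j h]
  · rw [hA.matMul_apply_of_notMem_left B hi, hB i j h]

theorem IdOff.toBlock_matMul {S : Finset I} {A : I → I → ℚ_[p]} (hA : IdOff S A)
    (B : I → I → ℚ_[p]) : toBlock S (_root_.matMul p A B) = toBlock S A * toBlock S B := by
  ext i j
  simp only [toBlock, Matrix.mul_apply, Matrix.of_apply, _root_.matMul]
  rw [finsum_eq_sum_of_support_subset (s := S),
    ← Finset.sum_coe_sort S fun l => A i l * B l j]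
  intro l hl
  by_contra hlS
  refine hl ?_
  have hil : (i : I) ≠ l := fun h => hlS (h ▸ i.2)
  simp [hA i l (Or.inr hlS), idMat, hil]

theorem IdOff.of_inverse {S : Finset I} {A B : I → I → ℚ_[p]} (hA : IdOff S A)
    (hAB : _root_.matMul p A B = idMat p) (hBA : _root_.matMul p B A = idMat p) :
    IdOff S B := by
  rintro i j (hi | hj)
  · rw [← hA.matMul_apply_of_notMem_left B hi, hAB]
  · rw [← hA.matMul_apply_of_notMem_right B i hj, hBA]

theorem IsInvMat.matMul {A B : I → I → ℚ_[p]} (hA : IsFinitary p A) (hA' : IsInvMat p A)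
    (hB : IsFinitary p B) (hB' : IsInvMat p B) :
    IsFinitary p (_root_.matMul p A B) ∧ IsInvMat p (_root_.matMul p A B) := by
  obtain ⟨S₁, hS₁⟩ := hA.exists_idOff
  obtain ⟨S₂, hS₂⟩ := hB.exists_idOff
  replace hA := hS₁.mono (Finset.subset_union_left (s₂ := S₂))
  replace hB := hS₂.mono (Finset.subset_union_right (s₁ := S₁))
  generalize S₁ ∪ S₂ = S at hA hB
  obtain ⟨A', h1, h2⟩ := hA'
  obtain ⟨B', h3, h4⟩ := hB'
  have hA' := hA.of_inverse h1 h2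
  have hB' := hB.of_inverse h3 h4
  have e1 := congrArg (toBlock S) h1
  have e2 := congrArg (toBlock S) h2
  have e3 := congrArg (toBlock S) h3
  have e4 := congrArg (toBlock S) h4
  rw [IdOff.toBlock_matMul ‹_›, toBlock_idMat] at e1 e2 e3 e4
  refine ⟨(hA.matMul hB).isFinitary, _root_.matMul p B' A', ?_, ?_⟩
  · refine ((hA.matMul hB).matMul (hB'.matMul hA')).ext (idOff_idMat S) ?_
    rw [(hA.matMul hB).toBlock_matMul, hA.toBlock_matMul, hB'.toBlock_matMul, toBlock_idMat,
      mul_assoc, ← mul_assoc (toBlock S B), e3, one_mul, e1]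
  · refine ((hB'.matMul hA').matMul (hA.matMul hB)).ext (idOff_idMat S) ?_
    rw [(hB'.matMul hA').toBlock_matMul, hA.toBlock_matMul, hB'.toBlock_matMul, toBlock_idMat,
      mul_assoc, ← mul_assoc (toBlock S A'), e2, one_mul, e4]

/-- A finitary matrix whose transpose is a left inverse is invertible. -/
theorem IsFinitary.isInvMat_of_transpose_matMul {A : I → I → ℚ_[p]} (hA : IsFinitary p A)
    (h : matMul p (fun i j => A j i) A = idMat p) : IsInvMat p A := by
  obtain ⟨S, hS⟩ := hA.exists_idOff
  refine ⟨_, (hS.matMul hS.transpose).ext (idOff_idMat S) ?_, h⟩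
  have e := congrArg (toBlock S) h
  rw [hS.transpose.toBlock_matMul, toBlock_idMat] at e
  rw [hS.toBlock_matMul, toBlock_idMat]
  exact mul_eq_one_comm.1 e

/-- Matrices supported on complementary blocks commute. -/
theorem IdOff.matMul_comm {S : Finset I} {A B : I → I → ℚ_[p]} (hA : IdOff S A)
    (hB : ∀ i j, (i ∈ S ∨ j ∈ S) → B i j = idMat p i j) :
    _root_.matMul p A B = _root_.matMul p B A := by
  funext i j
  by_cases hi : i ∈ S
  · trans A i j
    · conv_rhs => rw [← matMul_idMat A]
      refine finsum_congr fun l => ?_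
      by_cases hl : l ∈ S
      · rw [hB l j (Or.inl hl)]
      · have hil : i ≠ l := fun h => hl (h ▸ hi)
        simp [hA i l (Or.inr hl), idMat, hil]
    · conv_lhs => rw [← idMat_matMul A]
      exact finsum_congr fun l => by rw [hB i l (Or.inl hi)]
  · rw [hA.matMul_apply_of_notMem_left B hi]
    conv_lhs => rw [← matMul_idMat B]
    refine finsum_congr fun l => ?_
    by_cases hl : l ∈ S
    · have hil : i ≠ l := fun h => hi (h ▸ hl)
      simp [hB i l (Or.inr hl), idMat, hil]
    · rw [hA l j (Or.inl hl)]

end BlockMatrices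

section PermutationMatrices

variable {p : ℕ} [Fact p.Prime] {I : Type*} [DecidableEq I]

/-- The matrix sending `e_j` to `e_{σ j}`. -/
noncomputable def permMat (p : ℕ) [Fact p.Prime] {I : Type*} [DecidableEq I]
    (σ : Equiv.Perm I) : I → I → ℚ_[p] :=
  fun i j => if i = σ j then 1 else 0

theorem matMul_permMat (A : I → I → ℚ_[p]) (σ : Equiv.Perm I) (i j : I) :
    matMul p A (permMat p σ) i j = A i (σ j) := by
  rw [matMul, finsum_eq_single _ (σ j) fun l hl => by simp [permMat, hl]]
  simp [permMat]

theorem permMat_matMul (A : I → I → ℚ_[p]) (σ : Equiv.Perm I) (i j : I) :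
    matMul p (permMat p σ) A (σ i) j = A i j := by
  rw [matMul, finsum_eq_single _ i fun l hl => by simp [permMat, hl.symm]]
  simp [permMat]

/-- The permutation has finite support. -/
def FinSupp (σ : Equiv.Perm ℕ) : Prop := ∃ m, ∀ i, m ≤ i → σ i = i

theorem FinSupp.inv {σ : Equiv.Perm ℕ} (h : FinSupp σ) : FinSupp σ⁻¹ := by
  obtain ⟨m, hm⟩ := h
  exact ⟨m, fun i hi => by rw [Equiv.Perm.inv_eq_iff_eq, hm i hi]⟩

theorem FinSupp.mul {σ τ : Equiv.Perm ℕ} (hσ : FinSupp σ) (hτ : FinSupp τ) :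
    FinSupp (σ * τ) := by
  obtain ⟨m, hm⟩ := hσ
  obtain ⟨n, hn⟩ := hτ
  refine ⟨max m n, fun i hi => ?_⟩
  rw [Equiv.Perm.mul_apply, hn i (le_of_max_le_right hi), hm i (le_of_max_le_left hi)]

theorem permMat_eq_idMat {σ : Equiv.Perm I} {i j : I} (h : σ i = i ∨ σ j = j) :
    permMat p σ i j = idMat p i j := by
  rcases h with h | h
  · simp only [permMat, idMat]
    conv_lhs => rw [← h]
    simp
  · simp [permMat, idMat, h]

theorem FinSupp.isOrth {σ : Equiv.Perm ℕ} (h : FinSupp σ) : IsOrth p (permMat p σ) := by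
  obtain ⟨m, hm⟩ := h
  refine ⟨fun i j => ?_, IdOff.isFinitary (S := Finset.range m) fun i j hij => ?_, fun i j => ?_⟩
  · unfold permMat; split_ifs <;> simp
  · simp only [Finset.mem_range, not_lt] at hij
    exact permMat_eq_idMat (hij.imp (hm i) (hm j))
  · rw [finsum_eq_single _ (σ j) fun l hl => by simp [permMat, hl]]
    simp [permMat, idMat, eq_comm]

/-- The map exchanging `a + i` and `b + i` for `i < n`. -/
def blockSwapFun (a b n i : ℕ) : ℕ :=
  if a ≤ i ∧ i < a + n then i + (b - a) else if b ≤ i ∧ i < b + n then i - (b - a) else i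

theorem blockSwapFun_involutive {a b n : ℕ} (h : a + n ≤ b) :
    Function.Involutive (blockSwapFun a b n) := by
  intro i
  unfold blockSwapFun
  split_ifs <;> omega

/-- The permutation exchanging `a + i` and `b + i` for `i < n`. -/
def blockSwap (a b n : ℕ) (h : a + n ≤ b) : Equiv.Perm ℕ := (blockSwapFun_involutive h).toPerm

theorem blockSwap_apply {a b n : ℕ} (h : a + n ≤ b) (i : ℕ) :
    blockSwap a b n h i = blockSwapFun a b n i := rfl

theorem blockSwap_inv {a b n : ℕ} (h : a + n ≤ b) :
    (blockSwap a b n h)⁻¹ = blockSwap a b n h := rfl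

theorem finSupp_blockSwap {a b n : ℕ} (h : a + n ≤ b) : FinSupp (blockSwap a b n h) :=
  ⟨b + n, fun i hi => by rw [blockSwap_apply, blockSwapFun]; split_ifs <;> omega⟩

/-- The permutation underlying `Θ_N`. -/
def thetaPerm (N : ℕ) : Equiv.Perm ℕ := blockSwap 0 N N (by omega)

theorem thetaPerm_apply (N i : ℕ) : thetaPerm N i = blockSwapFun 0 N N i := rfl

theorem finSupp_thetaPerm (N : ℕ) : FinSupp (thetaPerm N) := finSupp_blockSwap _

theorem thetaMat_eq_permMat (N : ℕ) : ThetaMat p N = permMat p (thetaPerm N) := by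
  funext i j
  have : (if j < N then j + N else if j < 2 * N then j - N else j) = thetaPerm N j := by
    rw [thetaPerm_apply, blockSwapFun]
    split_ifs <;> omega
  simp only [ThetaMat, permMat, this]

/-- The double coset of `Θ_N` modulo permutations fixing `{0, …, n - 1}` does not depend on
`N ≥ n`. -/
theorem exists_thetaPerm_eq {n N M : ℕ} (hN : n ≤ N) (hM : N + n ≤ M) :
    ∃ a b : Equiv.Perm ℕ, FinSupp a ∧ FinSupp b ∧ (∀ i < n, a i = i) ∧ (∀ i < n, b i = i) ∧
      thetaPerm M = b * (thetaPerm N * a) := by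
  have ha : FinSupp (blockSwap N M n hM) := finSupp_blockSwap hM
  have ha' : ∀ i < n, blockSwap N M n hM i = i := fun i hi => by
    rw [blockSwap_apply, blockSwapFun]; split_ifs <;> omega
  refine ⟨blockSwap N M n hM, thetaPerm M * (thetaPerm N * blockSwap N M n hM)⁻¹, ha,
    (finSupp_thetaPerm M).mul ((finSupp_thetaPerm N).mul ha).inv, ha', fun i hi => ?_, by group⟩
  have h1 : (thetaPerm N)⁻¹ = thetaPerm N := rfl
  rw [mul_inv_rev, h1, blockSwap_inv]
  simp only [Equiv.Perm.mul_apply, thetaPerm_apply, blockSwap_apply]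
  have e1 : blockSwapFun 0 N N i = N + i := by
    unfold blockSwapFun; split_ifs <;> omega
  have e2 : blockSwapFun N M n (N + i) = M + i := by
    unfold blockSwapFun; split_ifs <;> omega
  rw [e1, e2]
  unfold blockSwapFun; split_ifs <;> omega

theorem IsOrth.conj {u : ℕ → ℕ → ℚ_[p]} (hu : IsOrth p u) (σ : Equiv.Perm ℕ) :
    IsOrth p (fun i j => u (σ i) (σ j)) := by
  obtain ⟨h1, h2, h3⟩ := hu
  have hid : ∀ i j, idMat p (σ i) (σ j) = idMat p i j := fun i j => by simp [idMat]
  refine ⟨fun i j => h1 _ _, ?_, fun i j => ?_⟩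
  · refine (Set.Finite.preimage ((σ.prodCongr σ).injective.injOn) h2).subset fun x hx => ?_
    simpa [hid] using hx
  · rw [← hid, ← h3]
    exact finsum_comp_equiv σ (f := fun l => u l (σ i) * u l (σ j))

end PermutationMatrices

section Embedding

variable {p : ℕ} [Fact p.Prime] {α k : ℕ}

theorem isFinitary_Jembed {u : ℕ → ℕ → ℚ_[p]} (hu : IsFinitary p u) :
    IsFinitary p (Jembed p α k u) := by
  refine (((Set.finite_univ (α := Fin k)).prod hu).image
    fun x => ((Sum.inr (x.1, x.2.1), Sum.inr (x.1, x.2.2)) :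
      (Fin α ⊕ Fin k × ℕ) × (Fin α ⊕ Fin k × ℕ))).subset ?_
  rintro ⟨a | ⟨s, i⟩, b | ⟨t, j⟩⟩ h
  · simp [Jembed, idMat] at h
  · simp [Jembed, idMat] at h
  · simp [Jembed, idMat] at h
  · by_cases hst : s = t
    · subst hst
      refine ⟨(s, (i, j)), ⟨Set.mem_univ _, ?_⟩, rfl⟩
      simpa [Jembed, idMat] using h
    · simp [Jembed, idMat, hst] at h

theorem transpose_matMul_Jembed {u : ℕ → ℕ → ℚ_[p]} (hu : IsOrth p u) :
    matMul p (fun i j => Jembed p α k u j i) (Jembed p α k u) = idMat p := by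
  funext x y
  rcases x with a | ⟨s, i⟩
  · rw [matMul, finsum_eq_single _ (Sum.inl a)]
    · rcases y with b | y <;> simp [Jembed, idMat]
    · rintro (b | z) hz
      · simp [Jembed, show b ≠ a from fun h => hz (h ▸ rfl)]
      · simp [Jembed]
  · have hinj : Function.Injective fun l : ℕ => (Sum.inr (s, l) : Fin α ⊕ Fin k × ℕ) :=
      fun l m h => by simpa using h
    have hsupp : ∀ z ∉ Set.range fun l : ℕ => (Sum.inr (s, l) : Fin α ⊕ Fin k × ℕ),
        Jembed p α k u z (Sum.inr (s, i)) * Jembed p α k u z y = 0 := by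
      rintro (b | ⟨t, l⟩) hz
      · simp [Jembed]
      · simp only [Set.mem_range, Sum.inr.injEq, Prod.mk.injEq, exists_eq_right] at hz
        simp [Jembed, show t ≠ s from fun h => hz h.symm]
    rw [matMul, ← finsum_mem_univ, ← finsum_mem_inter_support_eq' _
      (Set.range fun l : ℕ => (Sum.inr (s, l) : Fin α ⊕ Fin k × ℕ)), finsum_mem_range hinj]
    · rcases y with b | ⟨t, j⟩
      · simp [Jembed, idMat]
      · by_cases hst : s = t
        · subst hst
          simpa [Jembed, idMat] using hu.2.2 i j
        · simp [Jembed, idMat, hst]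
    · intro z hz
      simp only [Set.mem_univ, iff_true]
      by_contra h
      exact hz (hsupp z h)

theorem IsOrth.inGL_Jembed {u : ℕ → ℕ → ℚ_[p]} (hu : IsOrth p u) :
    InGL p α k (Jembed p α k u) :=
  ⟨isFinitary_Jembed hu.2.1,
    (isFinitary_Jembed hu.2.1).isInvMat_of_transpose_matMul (transpose_matMul_Jembed hu)⟩

/-- The permutation of the index set of `GL(α + k∞)` given by `σ` on each of the `k` copies
of `ℕ`. -/
def diagPerm (α k : ℕ) (σ : Equiv.Perm ℕ) : Equiv.Perm (Fin α ⊕ Fin k × ℕ) :=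
  Equiv.sumCongr (Equiv.refl _) (Equiv.prodCongr (Equiv.refl _) σ)

theorem Jembed_permMat (σ : Equiv.Perm ℕ) :
    Jembed p α k (permMat p σ) = permMat p (diagPerm α k σ) := by
  funext x y
  rcases x with a | ⟨s, i⟩ <;> rcases y with b | ⟨t, j⟩ <;>
    simp [Jembed, permMat, diagPerm, ite_and]

theorem Jembed_permMat_mul (σ τ : Equiv.Perm ℕ) :
    Jembed p α k (permMat p (σ * τ)) =
      matMul p (Jembed p α k (permMat p σ)) (Jembed p α k (permMat p τ)) := by
  simp only [Jembed_permMat]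
  funext x y
  rw [matMul_permMat]
  rcases x with a | ⟨s, i⟩ <;> rcases y with b | ⟨t, j⟩ <;> simp [permMat, diagPerm]

theorem Jembed_matMul_permMat (u : ℕ → ℕ → ℚ_[p]) (σ : Equiv.Perm ℕ) :
    matMul p (Jembed p α k u) (Jembed p α k (permMat p σ)) =
      matMul p (Jembed p α k (permMat p σ)) (Jembed p α k fun i j => u (σ i) (σ j)) := by
  simp only [Jembed_permMat]
  funext x y
  obtain ⟨x, rfl⟩ := (diagPerm α k σ).surjective x
  rw [matMul_permMat, permMat_matMul]
  rcases x with a | ⟨s, i⟩ <;> rcases y with b | ⟨t, j⟩ <;> simp [Jembed, diagPerm]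

/-- A finitary matrix commutes with `𝔍(u)` as soon as `u` fixes enough basis vectors. -/
theorem IsFinitary.exists_matMul_Jembed_comm
    {g : (Fin α ⊕ Fin k × ℕ) → (Fin α ⊕ Fin k × ℕ) → ℚ_[p]} (hg : IsFinitary p g) :
    ∃ n : ℕ, ∀ u : ℕ → ℕ → ℚ_[p], (∀ i j, (i < n ∨ j < n) → u i j = idMat p i j) →
      matMul p g (Jembed p α k u) = matMul p (Jembed p α k u) g := by
  obtain ⟨S, hS⟩ := hg.exists_idOff
  refine ⟨S.sup (Sum.elim (fun _ => 0) fun x => x.2 + 1), fun u hu => hS.matMul_comm ?_⟩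
  have hlt : ∀ (s : Fin k) (i : ℕ), Sum.inr (s, i) ∈ S →
      i < S.sup (Sum.elim (fun _ => 0) fun x => x.2 + 1) := fun s i h =>
    Finset.le_sup (f := Sum.elim (fun _ => 0) fun x => x.2 + 1) h
  rintro (a | ⟨s, i⟩) (b | ⟨t, j⟩) h
  · simp [Jembed, idMat]
  · simp [Jembed, idMat]
  · simp [Jembed, idMat]
  · have := hu i j (h.imp (hlt s i) (hlt t j))
    simp only [Jembed, this]
    simp [idMat, ite_and]

end Embedding

open Filter Topology in
/-- A bounded sequence in a Hilbert space has a weak cluster point. -/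
theorem exists_weak_clusterPt {E : Type*} [NormedAddCommGroup E] [InnerProductSpace ℂ E]
    [CompleteSpace E] (x : ℕ → E) (C : ℝ) (hx : ∀ N, ‖x N‖ ≤ C) :
    ∃ (y : E) (l : Filter ℕ), l.NeBot ∧ l ≤ atTop ∧
      ∀ w, Tendsto (fun N => inner ℂ (x N) w) l (𝓝 (inner ℂ y w)) := by
  let f : ℕ → WeakDual ℂ E := fun N => StrongDual.toWeakDual (InnerProductSpace.toDual ℂ E (x N))
  have hf : ∀ N, f N ∈ WeakDual.toStrongDual ⁻¹' Metric.closedBall (0 : StrongDual ℂ E) C := by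
    intro N
    simpa [f] using hx N
  obtain ⟨φ, -, hφ⟩ := (WeakDual.isCompact_closedBall (𝕜 := ℂ) (E := E) 0 C).ultrafilter_le_nhds
    ((hyperfilter ℕ).map f) (by
      rw [Ultrafilter.coe_map, le_principal_iff, mem_map]
      exact Filter.univ_mem' hf)
  refine ⟨(InnerProductSpace.toDual ℂ E).symm (WeakDual.toStrongDual φ), hyperfilter ℕ,
    inferInstance, Nat.hyperfilter_le_atTop, fun w => ?_⟩
  have hφ' : Tendsto f (hyperfilter ℕ) (𝓝 φ) := hφ
  have := ((WeakDual.eval_continuous w).tendsto φ).comp hφ'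
  rw [InnerProductSpace.toDual_symm_apply]
  exact this

open Filter Topology in
/-- On vectors fixed by the subgroup of `K` fixing the first `n` basis vectors of each copy,
the matrix coefficients of `Θ_N` with `N ≥ n` are those of the projection onto `𝓗^K`. -/
theorem inner_theta_eq_inner_proj {p : ℕ} [Fact p.Prime] {α k : ℕ}
    {𝓗 : Type*} [NormedAddCommGroup 𝓗] [InnerProductSpace ℂ 𝓗] [CompleteSpace 𝓗]
    {ρ : ((Fin α ⊕ Fin k × ℕ) → (Fin α ⊕ Fin k × ℕ) → ℚ_[p]) → (𝓗 →L[ℂ] 𝓗)}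
    (hρ_unitary : ∀ g, InGL p α k g → ρ g ∈ unitary (𝓗 →L[ℂ] 𝓗))
    (hρ_mul : ∀ g h, InGL p α k g → InGL p α k h → ρ (matMul p g h) = ρ g * ρ h)
    {P : 𝓗 →L[ℂ] 𝓗}
    (hP_into : ∀ v : 𝓗, ∀ u : ℕ → ℕ → ℚ_[p], IsOrth p u → ρ (Jembed p α k u) (P v) = P v)
    (hP_fix : ∀ v : 𝓗, (∀ u : ℕ → ℕ → ℚ_[p], IsOrth p u → ρ (Jembed p α k u) v = v) → P v = v)
    (hP_sa : IsSelfAdjoint P) {n : ℕ} {v w : 𝓗}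
    (hv : ∀ u : ℕ → ℕ → ℚ_[p], IsOrth p u → (∀ i j, (i < n ∨ j < n) → u i j = idMat p i j) →
      ρ (Jembed p α k u) v = v)
    (hw : ∀ u : ℕ → ℕ → ℚ_[p], IsOrth p u → (∀ i j, (i < n ∨ j < n) → u i j = idMat p i j) →
      ρ (Jembed p α k u) w = w)
    {N : ℕ} (hN : n ≤ N) :
    inner ℂ (ρ (Jembed p α k (ThetaMat p N)) v) w = inner ℂ (P v) w := by
  have horth (M : ℕ) : IsOrth p (ThetaMat p M) :=
    thetaMat_eq_permMat (p := p) M ▸ (finSupp_thetaPerm M).isOrth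
  have hinner {u : ℕ → ℕ → ℚ_[p]} (hu : IsOrth p u) (x y : 𝓗) :
      inner ℂ (ρ (Jembed p α k u) x) (ρ (Jembed p α k u) y) = inner ℂ x y :=
    ContinuousLinearMap.inner_map_map_of_mem_unitary (hρ_unitary _ hu.inGL_Jembed) x y
  have hP_symm (x y : 𝓗) : inner ℂ (P x) y = inner ℂ x (P y) := hP_sa.isSymmetric x y
  obtain ⟨y, l, hl, hle, hy⟩ := exists_weak_clusterPt
    (fun M => ρ (Jembed p α k (ThetaMat p M)) v) ‖v‖ fun M =>
      (ContinuousLinearMap.norm_map_of_mem_unitary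
        (hρ_unitary _ (horth M).inGL_Jembed) v).le
  have hy_fix : P y = y := by
    refine hP_fix y fun u hu => ext_inner_right ℂ fun z => ?_
    have h1 := hy ((ρ (Jembed p α k u)).adjoint z)
    simp only [ContinuousLinearMap.adjoint_inner_right] at h1
    refine tendsto_nhds_unique h1 ((hy z).congr' ?_)
    obtain ⟨S, hS⟩ := hu.2.1.exists_idOff
    obtain ⟨m, hm⟩ := S.exists_nat_subset_range
    filter_upwards [hle (eventually_ge_atTop (max m n))] with M hM
    rw [thetaMat_eq_permMat]
    have hperm : InGL p α k (Jembed p α k (permMat p (thetaPerm M))) :=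
      (finSupp_thetaPerm M).isOrth.inGL_Jembed
    have hconj := hu.conj (thetaPerm M)
    rw [← mul_apply_eq_comp, ← hρ_mul _ _ hu.inGL_Jembed hperm,
      Jembed_matMul_permMat, hρ_mul _ _ hperm hconj.inGL_Jembed,
      mul_apply_eq_comp, hv _ hconj]
    intro i j hij
    have hout (i : ℕ) (hi : i < n) : thetaPerm M i ∉ S := fun h => by
      have := Finset.mem_range.1 (hm h)
      rw [thetaPerm_apply, blockSwapFun] at this
      split_ifs at this <;> omega
    rw [hS _ _ (hij.imp (hout i) (hout j))]
    simp [idMat]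
  have hy_eq : y = P v := by
    refine ext_inner_right ℂ fun z => ?_
    rw [← hy_fix, hP_symm, hP_symm]
    refine tendsto_nhds_unique (hy (P z)) (tendsto_const_nhds.congr fun M => ?_)
    conv_rhs => rw [← hP_into z _ (horth M)]
    rw [hinner (horth M)]
  rw [← hy_eq]
  refine tendsto_nhds_unique (tendsto_const_nhds.congr' ?_) (hy w)
  filter_upwards [hle (eventually_ge_atTop (N + n))] with M hM
  obtain ⟨a, b, ha, hb, han, hbn, hab⟩ := exists_thetaPerm_eq hN hM
  have hfix {σ : Equiv.Perm ℕ} (hσ : ∀ i < n, σ i = i) (i j : ℕ) (hij : i < n ∨ j < n) :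
      permMat p σ i j = idMat p i j := permMat_eq_idMat (hij.imp (hσ i) (hσ j))
  have hθ := finSupp_thetaPerm N
  rw [thetaMat_eq_permMat, thetaMat_eq_permMat, hab, Jembed_permMat_mul,
    hρ_mul _ _ hb.isOrth.inGL_Jembed (hθ.mul ha).isOrth.inGL_Jembed, Jembed_permMat_mul,
    hρ_mul _ _ hθ.isOrth.inGL_Jembed ha.isOrth.inGL_Jembed, mul_apply_eq_comp,
    mul_apply_eq_comp, hv _ ha.isOrth (hfix han)]
  conv_rhs => rw [← hw _ hb.isOrth (hfix hbn)]
  rw [hinner hb.isOrth]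

/-- **The multiplicativity theorem.** Let `ρ` be a unitary representation of
`G = GL(α + k∞, ℚ_p)` on a complex Hilbert space `𝓗`, let `𝓗^K` be the space of
`K`-fixed vectors (for `K = 𝔍(O(∞, ℤ_p))`) and `P` the orthogonal projection onto `𝓗^K`
(characterized by: `P` maps into `𝓗^K`, fixes `𝓗^K` pointwise, and is self-adjoint).
Then for all `g, h ∈ G` there is `N₀` such that for all `N ≥ N₀`,
`P ∘ ρ(g) ∘ P ∘ ρ(h) ∘ P = P ∘ ρ(g·𝔍(Θ_N)·h) ∘ P`. -/
theorem multiplicativity_theorem (p : ℕ) [Fact p.Prime] (α k : ℕ) (hk : 1 ≤ k)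
    {𝓗 : Type*} [NormedAddCommGroup 𝓗] [InnerProductSpace ℂ 𝓗] [CompleteSpace 𝓗]
    (ρ : ((Fin α ⊕ Fin k × ℕ) → (Fin α ⊕ Fin k × ℕ) → ℚ_[p]) → (𝓗 →L[ℂ] 𝓗))
    (hρ_unitary : ∀ g, InGL p α k g → ρ g ∈ unitary (𝓗 →L[ℂ] 𝓗))
    (hρ_one : ρ (idMat p) = 1)
    (hρ_mul : ∀ g h, InGL p α k g → InGL p α k h → ρ (matMul p g h) = ρ g * ρ h)
    (P : 𝓗 →L[ℂ] 𝓗)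
    (hP_into : ∀ v : 𝓗, ∀ u : ℕ → ℕ → ℚ_[p], IsOrth p u → ρ (Jembed p α k u) (P v) = P v)
    (hP_fix : ∀ v : 𝓗, (∀ u : ℕ → ℕ → ℚ_[p], IsOrth p u → ρ (Jembed p α k u) v = v) → P v = v)
    (hP_sa : IsSelfAdjoint P)
    (g h : (Fin α ⊕ Fin k × ℕ) → (Fin α ⊕ Fin k × ℕ) → ℚ_[p])
    (hg : InGL p α k g) (hh : InGL p α k h) :
    ∃ N₀ : ℕ, ∀ N : ℕ, N₀ ≤ N →
      P * ρ g * P * ρ h * P =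
        P * ρ (matMul p (matMul p g (Jembed p α k (ThetaMat p N))) h) * P := by
  obtain ⟨m, hm⟩ := hg.1.exists_matMul_Jembed_comm
  obtain ⟨n, hn⟩ := hh.1.exists_matMul_Jembed_comm
  refine ⟨max m n, fun N hN => ?_⟩
  have hΘ : InGL p α k (Jembed p α k (ThetaMat p N)) :=
    thetaMat_eq_permMat (p := p) N ▸ (finSupp_thetaPerm N).isOrth.inGL_Jembed
  have hgΘ : InGL p α k (matMul p g (Jembed p α k (ThetaMat p N))) :=
    IsInvMat.matMul hg.1 hg.2 hΘ.1 hΘ.2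
  rw [hρ_mul _ _ hgΘ hh, hρ_mul _ _ hg hΘ]
  ext a
  refine ext_inner_right ℂ fun b => ?_
  have hP_symm (x y : 𝓗) : inner ℂ (P x) y = inner ℂ x (P y) := hP_sa.isSymmetric x y
  simp only [mul_apply_eq_comp]
  rw [hP_symm, hP_symm, ← ContinuousLinearMap.adjoint_inner_right,
    ← ContinuousLinearMap.adjoint_inner_right (ρ g)]
  refine (inner_theta_eq_inner_proj hρ_unitary hρ_mul hP_into hP_fix hP_sa (n := max m n)
    (fun u hu hun => ?_) (fun u hu hun => ?_) hN).symm
  · have hcomm := hn u fun i j hij => hun i j (by omega)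
    rw [← mul_apply_eq_comp, ← hρ_mul _ _ hu.inGL_Jembed hh, ← hcomm,
      hρ_mul _ _ hh hu.inGL_Jembed, mul_apply_eq_comp, hP_into a u hu]
  · have hcomm := hm u fun i j hij => hun i j (by omega)
    replace hcomm := congrArg ρ hcomm
    rw [hρ_mul _ _ hg hu.inGL_Jembed, hρ_mul _ _ hu.inGL_Jembed hg] at hcomm
    obtain ⟨h1, h2⟩ := Unitary.mem_iff.1 (hρ_unitary g hg)
    have hstar : ρ (Jembed p α k u) * star (ρ g) = star (ρ g) * ρ (Jembed p α k u) := by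
      calc ρ (Jembed p α k u) * star (ρ g)
          = star (ρ g) * ρ g * (ρ (Jembed p α k u) * star (ρ g)) := by rw [h1, one_mul]
        _ = star (ρ g) * (ρ g * ρ (Jembed p α k u)) * star (ρ g) := by simp only [mul_assoc]
        _ = star (ρ g) * ρ (Jembed p α k u) * (ρ g * star (ρ g)) := by
          rw [hcomm]; simp only [mul_assoc]
        _ = star (ρ g) * ρ (Jembed p α k u) := by rw [h2, mul_one]
    rw [ContinuousLinearMap.star_eq_adjoint] at hstar
    rw [← mul_apply_eq_comp, hstar, mul_apply_eq_comp, hP_into b u hu]
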